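/- For every generic t ∈ ℂⁿ and all indices m, p ∈ {1,…,n}: Σ_a Ψ̂^{am}_{ap}(t) = Q⁻_p(t) δ^m_p; that is, the trace of Ψ̂ over the first tensor factor equals the diagonal matrix Q⁻. -/

import Mathlib

noncomputable section

open Finset

/-- `t ∈ ℂⁿ` is generic if `t i - t j` is never an integer for `i ≠ j`. -/
def Generic {n : ℕ} (t : Fin n → ℂ) : Prop :=
  ∀ i j : Fin n, i ≠ j → ∀ m : ℤ, t i - t j ≠ (m : ℂ)

/-- the `k`-th standard basis vector of `ℤⁿ ⊂ ℂⁿ`. -/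
def eps {n : ℕ} (k : Fin n) : Fin n → ℂ := fun l => if l = k then 1 else 0

/-- Entries `R̂^{ij}_{kl}(t)` of the dynamical R-matrix: the only nonzero ones are
`R̂^{ij}_{ij} = 1/t_{ij}` for `i ≠ j`, `R̂^{ij}_{ji} = (t_{ij}² - 1)/t_{ij}²` for `i < j`
and `R̂^{ij}_{ji} = 1` for `i ≥ j`. -/
def Rhat {n : ℕ} (t : Fin n → ℂ) (i j k l : Fin n) : ℂ :=
  (if k = i ∧ l = j ∧ i ≠ j then (t i - t j)⁻¹ else 0) +
  (if k = j ∧ l = i then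
    (if i < j then ((t i - t j) ^ 2 - 1) / (t i - t j) ^ 2 else 1)
  else 0)

/-- `Q⁺_i(t) = ∏_{k ≠ i} (t_{ik} + 1)/t_{ik}`. -/
def Qp {n : ℕ} (t : Fin n → ℂ) (i : Fin n) : ℂ :=
  ∏ k ∈ Finset.univ.filter (fun k => k ≠ i), ((t i - t k) + 1) / (t i - t k)

/-- `Q⁻_i(t) = ∏_{k ≠ i} (t_{ik} - 1)/t_{ik}`. -/
def Qm {n : ℕ} (t : Fin n → ℂ) (i : Fin n) : ℂ :=
  ∏ k ∈ Finset.univ.filter (fun k => k ≠ i), ((t i - t k) - 1) / (t i - t k)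

/-- Entries `Ψ̂^{ij}_{kl}(t)`: the only nonzero ones are
`Ψ̂^{ij}_{ij} = Q⁺_i Q⁻_j/(t_{ij} + 1)` for all `i, j`, `Ψ̂^{ij}_{ji} = 1` for `i < j`
and `Ψ̂^{ij}_{ji} = (t_{ij} - 1)²/(t_{ij}(t_{ij} - 2))` for `i > j`. -/
def Psi {n : ℕ} (t : Fin n → ℂ) (a b c d : Fin n) : ℂ :=
  (if c = a ∧ d = b then Qp t a * Qm t b / ((t a - t b) + 1) else 0) +
  (if c = b ∧ d = a ∧ a ≠ b then
    (if a < b then 1 else ((t a - t b) - 1) ^ 2 / ((t a - t b) * ((t a - t b) - 2)))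
  else 0)

open Polynomial in
/-- A Lagrange interpolation identity: for pairwise distinct nodes, the divided difference of
the monic polynomial `∏_{k ≠ m} (X - t_k + 1)` of degree `n - 1` is its leading coefficient `1`. -/
theorem sum_prod_add_one_div_prod_eq_one {n : ℕ} {t : Fin n → ℂ} (ht : Function.Injective t)
    (m : Fin n) :
    ∑ a : Fin n, (∏ k ∈ univ.erase m, (t a - t k + 1)) / ∏ k ∈ univ.erase a, (t a - t k) = 1 := by
  set P : ℂ[X] := ∏ k ∈ univ.erase m, (X - C (t k - 1)) with hP
  have hmonic : P.Monic := monic_prod_X_sub_C _ _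
  have hdeg : (#(univ : Finset (Fin n)) : WithBot ℕ) = P.degree + 1 := by
    rw [hP, degree_prod]
    simp only [degree_X_sub_C, sum_const, nsmul_one]
    rw [← card_erase_add_one (mem_univ m)]
    norm_cast
  have hsum := Lagrange.leadingCoeff_eq_sum (ht.injOn (s := (univ : Finset (Fin n)))) hdeg
  rw [hmonic.leadingCoeff] at hsum
  refine (sum_congr rfl fun a _ => ?_).trans hsum.symm
  congr 1
  rw [hP, eval_prod]
  refine prod_congr rfl fun k _ => ?_
  simp only [eval_sub, eval_X, eval_C]
  ring

theorem Generic.injective {n : ℕ} {t : Fin n → ℂ} (ht : Generic t) : Function.Injective t := by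
  intro i j hij
  by_contra hne
  exact ht i j hne 0 (by simp [hij])

theorem Generic.sub_add_one_ne_zero {n : ℕ} {t : Fin n → ℂ} (ht : Generic t) (i j : Fin n) :
    t i - t j + 1 ≠ 0 := by
  rcases eq_or_ne i j with rfl | hij
  · simp
  · intro h
    exact ht i j hij (-1) (by push_cast; linear_combination h)

theorem Generic.Qp_div_sub_add_one {n : ℕ} {t : Fin n → ℂ} (ht : Generic t) (a m : Fin n) :
    Qp t a / (t a - t m + 1) =
      (∏ k ∈ univ.erase m, (t a - t k + 1)) / ∏ k ∈ univ.erase a, (t a - t k) := by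
  have hprod : ∏ k ∈ univ.erase a, (t a - t k + 1) =
      (t a - t m + 1) * ∏ k ∈ univ.erase m, (t a - t k + 1) := by
    rw [mul_prod_erase univ (fun k => t a - t k + 1) (mem_univ m),
      ← mul_prod_erase univ (fun k => t a - t k + 1) (mem_univ a)]
    simp
  rw [Qp, filter_ne', prod_div_distrib, hprod, div_right_comm,
    mul_div_cancel_left₀ _ (ht.sub_add_one_ne_zero a m)]

theorem Generic.sum_Qp_div_sub_add_one {n : ℕ} {t : Fin n → ℂ} (ht : Generic t) (m : Fin n) :
    ∑ a : Fin n, Qp t a / (t a - t m + 1) = 1 := by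
  simp_rw [ht.Qp_div_sub_add_one]
  exact sum_prod_add_one_div_prod_eq_one ht.injective m

theorem Psi_partial_trace_entry {n : ℕ} (t : Fin n → ℂ) (a m p : Fin n) :
    Psi t a m a p = if m = p then Qp t a / (t a - t m + 1) * Qm t m else 0 := by
  have hoff : ¬(a = m ∧ p = a ∧ a ≠ m) := fun h => h.2.2 h.1
  rw [Psi, if_neg hoff, add_zero]
  simp only [true_and, eq_comm (a := p), div_mul_eq_mul_div]

/-- The trace of `Ψ̂` over the first tensor factor is the diagonal matrix `Q⁻`. -/
theorem Psi_trace_first_eq_Qm {n : ℕ} (hn : 2 ≤ n) (t : Fin n → ℂ) (ht : Generic t)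
    (m p : Fin n) :
    ∑ a : Fin n, Psi t a m a p = if m = p then Qm t p else 0 := by
  simp_rw [Psi_partial_trace_entry]
  split_ifs with h
  · rw [← sum_mul, ht.sum_Qp_div_sub_add_one, one_mul, h]
  · exact sum_const_zero
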